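/- arXiv:2603.24400 — 2 statements merged into one kernel-verified Lean document; each statement's English description precedes it below -/
import Mathlib

section
/- Let r ≥ 1 and c ≥ 1 be integers, let S be a nonempty compact subset of ℝ^r, let z_1 < z_2 < ... < z_{c+1} be real numbers, and for each j ∈ {1,...,c} let β^j ∈ ℝ^r and β_0^j ∈ ℝ. Then there exist an integer m = 2c, vectors u_1,...,u_m ∈ ℝ^r, real numbers b_1,...,b_m, gate weights w_1,...,w_m, output weights v_1,...,v_m, perceptron parameters α_1,...,α_m, γ_1,...,γ_m, and a bias d ∈ ℝ such that for every j ∈ {1,...,c}, every x̂ ∈ S, and every t ∈ ℝ with z_j ≤ t < z_{j+1}, one has Σ_{k=1}^m v_k · max(0, ⟨u_k, x̂⟩ + b_k + w_k · 𝟙(α_k t + γ_k > 0)) + d = β_0^j + ⟨β^j, x̂⟩. In other words, every simple contextual linear regression function with c contexts can be represented exactly on S × [z_1, z_{c+1}) by a two-layer network consisting of 2c ReLU units whose pre-activations are shifted by gated outputs of c perceptron (Heaviside) units acting on the single contextual feature t, followed by one linear output unit. -/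
open scoped RealInnerProductSpace

/-- Every finite sequence in an abelian group is the sequence of partial sums of its increments. -/
lemma exists_increments {E : Type*} [AddCommGroup E] {c : ℕ} (f : Fin c → E) :
    ∃ D : Fin c → E, ∀ j, ∑ i, (if i ≤ j then D i else 0) = f j := by
  let F : ℕ → E := fun n => if h : 0 < n ∧ n - 1 < c then f ⟨n - 1, h.2⟩ else 0
  refine ⟨fun i => F (i + 1) - F i, fun j => ?_⟩
  calc ∑ i : Fin c, (if i ≤ j then F (i + 1) - F i else 0)
      = ∑ n ∈ Finset.range c, if n ≤ j then F (n + 1) - F n else 0 :=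
        Fin.sum_univ_eq_sum_range (fun n => if n ≤ j then F (n + 1) - F n else 0) c
    _ = ∑ n ∈ Finset.range (j + 1), (F (n + 1) - F n) := by
        rw [← Finset.sum_filter]
        congr 1
        ext n
        simp only [Finset.mem_filter, Finset.mem_range]
        omega
    _ = f j := by
        rw [Finset.sum_range_sub]
        simp [F]

/-- A pair of rectified linear units, both shut off by the same gate of strength `M`, computes a
value bounded by `M` when the gate is open and `0` when it is closed. -/
lemma relu_pair_gated {h M : ℝ} (hM : |h| ≤ M) (p : Prop) [Decidable p] :
    max 0 (h + -M * (if p then 1 else 0)) - max 0 (-h + -M * (if p then 1 else 0)) =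
      if p then 0 else h := by
  obtain ⟨h1, h2⟩ := abs_le.mp hM
  split_ifs
  · rw [max_eq_left (by linarith), max_eq_left (by linarith), sub_zero]
  · rcases le_total 0 h with hh | hh
    · rw [max_eq_right (by linarith), max_eq_left (by linarith)]; ring
    · rw [max_eq_left (by linarith), max_eq_right (by linarith)]; ring

/-- Every simple contextual linear regression function with `c` contexts
(cut points `z 0 < ... < z c`, context-`j` regression `x̂ ↦ β0 j + ⟪β j, x̂⟫`) can be
represented exactly on `S × [z 0, z c)` by a two-layer network with `2c` ReLU units whose
pre-activations are shifted by gated Heaviside perceptron units acting on the single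
contextual feature `t`, followed by one linear output unit. -/
theorem sctxtnn_representation
    (r c : ℕ) (hr : 1 ≤ r) (hc : 1 ≤ c)
    (S : Set (EuclideanSpace ℝ (Fin r))) (hS : IsCompact S) (hSne : S.Nonempty)
    (z : Fin (c + 1) → ℝ) (hz : StrictMono z)
    (β : Fin c → EuclideanSpace ℝ (Fin r)) (β0 : Fin c → ℝ) :
    ∃ (u : Fin (2 * c) → EuclideanSpace ℝ (Fin r))
      (b w v α γ : Fin (2 * c) → ℝ) (d : ℝ),
      ∀ j : Fin c, ∀ x ∈ S, ∀ t : ℝ,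
        z j.castSucc ≤ t → t < z j.succ →
        (∑ k : Fin (2 * c),
            v k * max 0 (⟪u k, x⟫ + b k + w k * (if α k * t + γ k > 0 then (1:ℝ) else 0)))
          + d = β0 j + ⟪β j, x⟫ := by
  obtain ⟨a, ha⟩ := exists_increments β
  obtain ⟨a0, ha0⟩ := exists_increments β0
  have hbound : ∀ i, ∃ M, ∀ x ∈ S, |⟪a i, x⟫ + a0 i| ≤ M := fun i =>
    hS.exists_bound_of_continuousOn (f := fun x => ⟪a i, x⟫ + a0 i) (by fun_prop)
  choose M hM using hbound
  let s : Fin 2 → ℝ := ![1, -1]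
  let e : Fin (2 * c) ≃ Fin 2 × Fin c := finProdFinEquiv.symm
  refine ⟨fun k => s (e k).1 • a (e k).2, fun k => s (e k).1 * a0 (e k).2, fun k => -M (e k).2,
    fun k => s (e k).1, fun _ => -1, fun k => z (e k).2.castSucc, 0, fun j x hx t hjt htj => ?_⟩
  have hgate : ∀ i : Fin c, -1 * t + z i.castSucc > 0 ↔ ¬ i ≤ j := by
    intro i
    constructor
    · intro h hij
      have := hz.monotone (Fin.castSucc_le_castSucc_iff.mpr hij)
      linarith
    · intro h
      have := hz.monotone (Fin.succ_le_castSucc_iff.mpr (not_le.mp h))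
      linarith
  rw [e.sum_comp (fun q => s q.1 * max 0 (⟪s q.1 • a q.2, x⟫ + s q.1 * a0 q.2 +
    -M q.2 * (if -1 * t + z q.2.castSucc > 0 then (1 : ℝ) else 0))),
    Fintype.sum_prod_type_right, add_zero]
  calc _ = ∑ i, ((if i ≤ j then a0 i else 0) + ⟪if i ≤ j then a i else 0, x⟫) := by
        refine Finset.sum_congr rfl fun i _ => ?_
        have hpair := relu_pair_gated (hM i x hx) (-1 * t + z i.castSucc > 0)
        have hneg : -⟪a i, x⟫ + -a0 i = -(⟪a i, x⟫ + a0 i) := by ring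
        simp only [Fin.sum_univ_two, s, Matrix.cons_val_zero, Matrix.cons_val_one, one_smul,
          one_mul, neg_smul, inner_neg_left, neg_one_mul (a0 i), hneg]
        rw [neg_one_mul (max _ _), ← sub_eq_add_neg, hpair]
        by_cases h : i ≤ j
        · rw [if_neg (fun h' => (hgate i).mp h' h), if_pos h, if_pos h, add_comm]
        · rw [if_pos ((hgate i).mpr h), if_neg h, if_neg h, inner_zero_left, add_zero]
    _ = β0 j + ⟪β j, x⟫ := by
        rw [Finset.sum_add_distrib, ← sum_inner, ha, ha0]
end

section
/- Let r ≥ 1, let S be a nonempty compact subset of ℝ^r, let β ∈ ℝ^r, β_0 ∈ ℝ, and z ∈ ℝ. Set M = sup_{x̂ ∈ S} |⟨β, x̂⟩|, b_1 = β_0 + |β_0| + M, b_2 = b_1 − β_0, and w = −2(M + 2|β_0|). Then for every x̂ ∈ S and every t ∈ ℝ: max(0, ⟨β, x̂⟩ + b_1 + w · 𝟙(t < z)) − max(0, b_2 + w · 𝟙(t < z)) = 𝟙(z ≤ t) · (β_0 + ⟨β, x̂⟩). That is, a pair of ReLU units whose pre-activations are shifted by a Heaviside gate on the contextual feature t exactly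 realizes the function (x̂, t) ↦ 𝟙(z ≤ t) · (β_0 + ⟨β, x̂⟩) on S × ℝ. -/
open scoped RealInnerProductSpace

/-- A pair of ReLU units whose pre-activations are shifted by a Heaviside gate
on the contextual feature `t` exactly realizes `(x̂, t) ↦ 𝟙(z ≤ t) * (β0 + ⟪β, x̂⟫)` on
`S × ℝ`, where `M = sup_{x̂ ∈ S} |⟪β, x̂⟫|`, `b1 = β0 + |β0| + M`, `b2 = b1 - β0`, and
`w = -2(M + 2|β0|)`. -/
theorem relu_pair_gated_indicator
    (r : ℕ) (hr : 1 ≤ r)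
    (S : Set (EuclideanSpace ℝ (Fin r))) (hS : IsCompact S) (hSne : S.Nonempty)
    (β : EuclideanSpace ℝ (Fin r)) (β0 z : ℝ)
    (M : ℝ) (hM : M = sSup ((fun x => |⟪β, x⟫|) '' S))
    (b1 : ℝ) (hb1 : b1 = β0 + |β0| + M)
    (b2 : ℝ) (hb2 : b2 = b1 - β0)
    (w : ℝ) (hw : w = -2 * (M + 2 * |β0|)) :
    ∀ x ∈ S, ∀ t : ℝ,
      max 0 (⟪β, x⟫ + b1 + w * (if t < z then (1:ℝ) else 0))
        - max 0 (b2 + w * (if t < z then (1:ℝ) else 0))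
      = (if z ≤ t then (1:ℝ) else 0) * (β0 + ⟪β, x⟫) := by
  intro x hx t
  have hbdd : BddAbove ((fun x => |⟪β, x⟫|) '' S) :=
    (hS.image (by fun_prop)).bddAbove
  have hle : |⟪β, x⟫| ≤ M := hM ▸ le_csSup hbdd (Set.mem_image_of_mem _ hx)
  obtain ⟨hlow, hupp⟩ := abs_le.mp hle
  have hβ0 := neg_abs_le β0
  have hβ0' := le_abs_self β0
  have hβ0n := abs_nonneg β0
  subst hb2 hb1 hw
  rcases lt_or_ge t z with h | h
  · rw [if_pos h, if_neg h.not_ge, max_eq_left (by linarith), max_eq_left (by linarith)]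
    ring
  · rw [if_neg h.not_gt, if_pos h, max_eq_right (by linarith), max_eq_right (by linarith)]
    ring
end
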